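/- In a minimal counterexample, every vertex of degree 5 satisfies at least one of the following: it has a neighbor of degree at least 9; it has at least two neighbors of degree at least 8; it has at least three neighbors of degree at least 7. -/

import Mathlib

open SimpleGraph

variable {V : Type}

/-- The involution of the darts of a graph reversing each dart. -/
def dartRev (G : SimpleGraph V) : Equiv.Perm G.Dart :=
  Function.Involutive.toPerm SimpleGraph.Dart.symm SimpleGraph.Dart.symm_involutive

/-- The face permutation of a rotation system `σ`: it sends a dart `(u,v)` to `σ (v,u)`. -/
def facePerm {G : SimpleGraph V} (σ : Equiv.Perm G.Dart) : Equiv.Perm G.Dart :=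
  (dartRev G).trans σ

/-- The setoid on `α` whose classes are the orbits (cycles) of a permutation of `α`. -/
def orbitSetoid {α : Type*} (f : Equiv.Perm α) : Setoid α :=
  ⟨f.SameCycle, ⟨fun x => Equiv.Perm.SameCycle.refl f x, fun h => h.symm, fun h h' => h.trans h'⟩⟩

/-- The number of faces of a rotation system: the number of orbits of the face permutation. -/
noncomputable def numFaces {G : SimpleGraph V} (σ : Equiv.Perm G.Dart) : ℕ :=
  Nat.card (Quotient (orbitSetoid (facePerm σ)))

/-- The number of darts in the face (orbit of the face permutation) containing the dart `d`. -/
noncomputable def faceSize {G : SimpleGraph V} (σ : Equiv.Perm G.Dart) (d : G.Dart) : ℕ :=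
  Nat.card {e : G.Dart // (facePerm σ).SameCycle d e}

/-- `σ` is a rotation system on `G`: every dart and its image share their first vertex, and
the `σ`-orbit of every dart consists of all darts sharing its first vertex. -/
structure IsRotationSystem (G : SimpleGraph V) (σ : Equiv.Perm G.Dart) : Prop where
  fst_eq : ∀ d : G.Dart, (σ d).toProd.1 = d.toProd.1
  orbit_eq : ∀ d e : G.Dart, d.toProd.1 = e.toProd.1 → σ.SameCycle d e

/-- The degree of a vertex. -/
noncomputable def deg (G : SimpleGraph V) (v : V) : ℕ := Nat.card (G.neighborSet v)

/-- A plane triangulation: a finite connected simple graph on at least 4 vertices equipped with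
a rotation system satisfying Euler's formula `|V| - |E| + F = 2` in which every face consists of
exactly 3 darts. -/
structure IsPlaneTriangulation [Fintype V] (G : SimpleGraph V) (σ : Equiv.Perm G.Dart) :
    Prop where
  connected : G.Connected
  four_le_card : 4 ≤ Fintype.card V
  rot : IsRotationSystem G σ
  euler : Fintype.card V + numFaces σ = Nat.card G.edgeSet + 2
  face_size_eq : ∀ d : G.Dart, faceSize σ d = 3

/-- A proper 5-coloring (colors `0,...,4` standing for `1,...,5`). -/
def Proper5 (G : SimpleGraph V) (c : V → Fin 5) : Prop :=
  ∀ ⦃u w : V⦄, G.Adj u w → c u ≠ c w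

/-- A finite simple graph is planar if it is isomorphic to a subgraph of a plane triangulation. -/
def IsPlanar [Fintype V] (G : SimpleGraph V) : Prop :=
  ∃ (W : Type) (iW : Fintype W) (T : SimpleGraph W) (σ : Equiv.Perm T.Dart),
    @IsPlaneTriangulation W iW T σ ∧ ∃ f : G →g T, Function.Injective f

/-- `w` is the neighbor of `v` following `u` in the cyclic (counterclockwise) order
around `v` given by the rotation system `σ`. -/
def NextNbr {G : SimpleGraph V} (σ : Equiv.Perm G.Dart) (v u w : V) : Prop :=
  ∃ h : G.Adj v u, (σ ⟨(v, u), h⟩).toProd.2 = w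

/-- A minimal counterexample: a plane triangulation admitting no proper 5-coloring with some
color class of size at most `|V|/6`, while every planar graph on fewer vertices admits one. -/
def IsMinimalCounterexample [Fintype V] (G : SimpleGraph V) (σ : Equiv.Perm G.Dart) : Prop :=
  IsPlaneTriangulation G σ ∧
  (¬ ∃ c : V → Fin 5, Proper5 G c ∧
      ∃ k : Fin 5, 6 * Nat.card {v : V | c v = k} ≤ Fintype.card V) ∧
  (∀ (W : Type) [Fintype W] (H : SimpleGraph W), IsPlanar H →
      Fintype.card W < Fintype.card V →
      ∃ c : W → Fin 5, Proper5 H c ∧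
        ∃ k : Fin 5, 6 * Nat.card {w : W | c w = k} ≤ Fintype.card W)

lemma my_edge_fiber {G : SimpleGraph V} [Fintype G.Dart] [DecidableEq V] [DecidableEq G.Dart]
    (d : G.Dart) :
    (Finset.univ.filter fun d' : G.Dart => d'.edge = d.edge) = {d, d.symm} :=
  Finset.ext fun d' => by simpa using dart_edge_eq_iff d' d

lemma my_finrank_span_le {M : Type*} [AddCommGroup M] [Module (ZMod 2) M] (x : M) :
    Module.finrank (ZMod 2) (Submodule.span (ZMod 2) {x}) ≤ 1 := by
  simpa using finrank_span_le_card (R := ZMod 2) ({x} : Set M)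

/-- A permutation whose orbit at `d` has `m` elements returns after `m` steps, injectively. -/
lemma orbit_card_facts {α : Type*} [Finite α] (f : Equiv.Perm α) (d : α) (m : ℕ)
    (hm : Nat.card {e : α // f.SameCycle d e} = m) :
    (f ^ m) d = d ∧ (∀ i j : ℕ, i < m → j < m → (f ^ i) d = (f ^ j) d → i = j) ∧
      (∀ e, f.SameCycle d e → ∃ i, i < m ∧ (f ^ i) d = e) := by
  classical
  have hper : Function.minimalPeriod f d = m := by
    rw [← hm, ← Nat.card_fin (Function.minimalPeriod f d)]
    have hpos : 0 < Function.minimalPeriod f d := by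
      apply Function.minimalPeriod_pos_of_mem_periodicPts
      exact Function.Injective.mem_periodicPts f.injective d
    apply Nat.card_congr
    refine Equiv.ofBijective (fun i : Fin (Function.minimalPeriod f d) =>
      (⟨(f ^ (i : ℕ)) d, ⟨(i : ℤ), by simp⟩⟩ : {e : α // f.SameCycle d e})) ⟨?_, ?_⟩
    · intro i j hij
      have h1 : (f ^ (i : ℕ)) d = (f ^ (j : ℕ)) d := congrArg Subtype.val hij
      rw [← Equiv.Perm.iterate_eq_pow, ← Equiv.Perm.iterate_eq_pow] at h1
      exact Fin.ext (Function.iterate_injOn_Iio_minimalPeriod i.2 j.2 h1)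
    · rintro ⟨e, he⟩
      obtain ⟨n, hn⟩ := he.exists_nat_pow_eq
      refine ⟨⟨n % Function.minimalPeriod f d, Nat.mod_lt _ hpos⟩, ?_⟩
      apply Subtype.ext
      change (f ^ (n % Function.minimalPeriod f d)) d = e
      rw [← hn, ← Equiv.Perm.iterate_eq_pow, ← Equiv.Perm.iterate_eq_pow,
        Function.iterate_mod_minimalPeriod_eq]
  refine ⟨?_, ?_, ?_⟩
  · rw [← hper, ← Equiv.Perm.iterate_eq_pow]
    exact Function.iterate_minimalPeriod
  · intro i j hi hj h1
    rw [← Equiv.Perm.iterate_eq_pow, ← Equiv.Perm.iterate_eq_pow] at h1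
    rw [← hper] at hi hj
    exact Function.iterate_injOn_Iio_minimalPeriod hi hj h1
  · intro e he
    have hpos : 0 < Function.minimalPeriod f d := by
      apply Function.minimalPeriod_pos_of_mem_periodicPts
      exact Function.Injective.mem_periodicPts f.injective d
    obtain ⟨n, hn⟩ := he.exists_nat_pow_eq
    refine ⟨n % Function.minimalPeriod f d, ?_, ?_⟩
    · rw [← hper]; exact Nat.mod_lt _ hpos
    · rw [← hn, ← Equiv.Perm.iterate_eq_pow, ← Equiv.Perm.iterate_eq_pow,
        Function.iterate_mod_minimalPeriod_eq]

lemma facePerm_apply {G : SimpleGraph V} (σ : Equiv.Perm G.Dart) (d : G.Dart) :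
    facePerm σ d = σ d.symm := rfl

lemma quot_symm_eq {G : SimpleGraph V} (σ : Equiv.Perm G.Dart) (d : G.Dart) :
    (Quotient.mk (orbitSetoid (facePerm σ)) d.symm) =
      Quotient.mk (orbitSetoid (facePerm σ)) (σ d) := by
  apply Quotient.sound
  refine ⟨1, ?_⟩
  simp [facePerm_apply]

/-- The mod 2 divergence of a single edge. -/
lemma single_edge_div {G : SimpleGraph V} [Fintype G.Dart] [DecidableEq V] {a b : V}
    (hab : G.Adj a b) (u : V) :
    ∑ d : G.Dart, (if d.fst = u then (if d.edge = s(a, b) then (1 : ZMod 2) else 0) else 0) =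
      (if a = u then 1 else 0) + (if b = u then 1 else 0) := by
  classical
  let d0 : G.Dart := ⟨(a, b), hab⟩
  have h2 : ∀ d : G.Dart,
      (if d.fst = u then (if d.edge = s(a, b) then (1 : ZMod 2) else 0) else 0) =
      if d.edge = d0.edge then (if d.fst = u then 1 else 0) else 0 := by
    intro d
    have : d0.edge = s(a, b) := rfl
    rw [this]
    by_cases h3 : d.edge = s(a, b) <;> simp [h3]
  rw [Finset.sum_congr rfl fun d _ => h2 d, ← Finset.sum_filter, my_edge_fiber,
    Finset.sum_pair d0.symm_ne.symm]
  simp [d0]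
  congr

/-- Every mod 2 cycle of a plane triangulation bounds a set of faces. -/
lemma cycle_bounds [Fintype V] (G : SimpleGraph V) [Fintype G.Dart] [DecidableEq V]
    (σ : Equiv.Perm G.Dart)
    (hT : IsPlaneTriangulation G σ) (e : G.edgeSet → ZMod 2)
    (he : ∀ u : V, ∑ d : G.Dart, (if d.fst = u then e ⟨d.edge, d.edge_mem⟩ else 0) = 0) :
    ∃ h : G.Dart → ZMod 2, (∀ d, h (σ d) = h d.symm) ∧
      ∀ d, e ⟨d.edge, d.edge_mem⟩ = h d + h d.symm := by
  classical
  have : Fintype G.edgeSet := Fintype.ofFinite _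
  set Q := Quotient (orbitSetoid (facePerm σ)) with hQ
  have : Fintype Q := Fintype.ofFinite _
  let bd : (Q → ZMod 2) →ₗ[ZMod 2] (G.edgeSet → ZMod 2) :=
    { toFun := fun h x => ∑ d : G.Dart, (if d.edge = x.1 then h (Quotient.mk _ d) else 0)
      map_add' := by
        intro a b
        funext x
        simp only [Pi.add_apply, ← Finset.sum_add_distrib]
        refine Finset.sum_congr rfl fun d _ => ?_
        split_ifs <;> simp
      map_smul' := by
        intro a b
        funext x
        simp only [Pi.smul_apply, smul_eq_mul, RingHom.id_apply, Finset.mul_sum]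
        refine Finset.sum_congr rfl fun d _ => ?_
        split_ifs <;> simp }
  let dv : (G.edgeSet → ZMod 2) →ₗ[ZMod 2] (V → ZMod 2) :=
    { toFun := fun x u => ∑ d : G.Dart, (if d.fst = u then x ⟨d.edge, d.edge_mem⟩ else 0)
      map_add' := by
        intro a b
        funext x
        simp only [Pi.add_apply, ← Finset.sum_add_distrib]
        refine Finset.sum_congr rfl fun d _ => ?_
        split_ifs <;> simp
      map_smul' := by
        intro a b
        funext x
        simp only [Pi.smul_apply, smul_eq_mul, RingHom.id_apply, Finset.mul_sum]
        refine Finset.sum_congr rfl fun d _ => ?_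
        split_ifs <;> simp }
  have hbd : ∀ h d, bd h ⟨Dart.edge d, d.edge_mem⟩ =
      h (Quotient.mk _ d) + h (Quotient.mk _ d.symm) := by
    intro h d
    change ∑ d' : G.Dart, (if d'.edge = d.edge then h (Quotient.mk _ d') else 0) = _
    rw [← Finset.sum_filter, my_edge_fiber, Finset.sum_pair d.symm_ne.symm]
  have hcomp : LinearMap.range bd ≤ LinearMap.ker dv := by
    rintro _ ⟨h, rfl⟩
    rw [LinearMap.mem_ker]
    funext u
    change ∑ d : G.Dart, (if d.fst = u then bd h ⟨d.edge, d.edge_mem⟩ else 0) = 0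
    simp only [hbd]
    have : ∀ d : G.Dart, (if d.fst = u then
        h (Quotient.mk _ d) + h (Quotient.mk _ d.symm) else 0) =
        (fun d : G.Dart => if d.fst = u then h (Quotient.mk _ d) else 0) d +
        (fun d : G.Dart => if d.fst = u then h (Quotient.mk _ d) else 0) (σ d) := by
      intro d
      have h1 := hT.rot.fst_eq d
      simp only [h1, quot_symm_eq]
      split_ifs <;> simp
    rw [Finset.sum_congr rfl fun d _ => this d, Finset.sum_add_distrib,
      Equiv.sum_comp σ (fun d : G.Dart => if d.fst = u then h (Quotient.mk _ d) else 0)]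
    exact CharTwo.add_self_eq_zero _
  have hV : (Fintype.card V) ≤ Module.finrank (ZMod 2) (LinearMap.range dv) + 1 := by
    obtain ⟨r⟩ := hT.connected.nonempty
    have hadj : ∀ u, (Pi.single u 1 : V → ZMod 2) + Pi.single r 1 ∈ LinearMap.range dv := by
      intro u
      have hreach := hT.connected.preconnected u r
      rw [SimpleGraph.reachable_iff_reflTransGen] at hreach
      induction hreach using Relation.ReflTransGen.head_induction_on with
      | refl =>
        have : (Pi.single r 1 : V → ZMod 2) + Pi.single r 1 = 0 := by
          funext x; exact CharTwo.add_self_eq_zero _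
        rw [this]; exact Submodule.zero_mem _
      | head hab _ ih =>
        rename_i a b _
        have hs : (Pi.single a 1 : V → ZMod 2) + Pi.single b 1 ∈ LinearMap.range dv := by
          refine ⟨fun x => if x.1 = s(a, b) then 1 else 0, ?_⟩
          funext u
          change ∑ d : G.Dart, (if d.fst = u then
            (if d.edge = s(a, b) then (1 : ZMod 2) else 0) else 0) = _
          rw [single_edge_div hab u]
          simp only [Pi.add_apply, Pi.single_apply, eq_comm (a := u)]
        have := Submodule.add_mem _ hs ih
        have h3 : (Pi.single a 1 : V → ZMod 2) + Pi.single b 1 +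
            (Pi.single b 1 + Pi.single r 1) = Pi.single a 1 + Pi.single r 1 := by
          funext x
          simp only [Pi.add_apply]
          generalize (Pi.single a 1 : V → ZMod 2) x = p
          generalize (Pi.single b 1 : V → ZMod 2) x = q
          generalize (Pi.single r 1 : V → ZMod 2) x = s
          revert p q s; decide
        rwa [h3] at this
    have htop : LinearMap.range dv ⊔ Submodule.span (ZMod 2) {(Pi.single r 1 : V → ZMod 2)} = ⊤ := by
      rw [eq_top_iff, ← (Pi.basisFun (ZMod 2) V).span_eq, Submodule.span_le]
      rintro _ ⟨u, rfl⟩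
      rw [Pi.basisFun_apply]
      have h4 : (Pi.single u 1 : V → ZMod 2) =
          (Pi.single u 1 + Pi.single r 1) + Pi.single r 1 := by
        funext x
        simp only [Pi.add_apply]
        generalize (Pi.single u 1 : V → ZMod 2) x = p
        generalize (Pi.single r 1 : V → ZMod 2) x = s
        revert p s; decide
      rw [h4]
      exact Submodule.add_mem_sup (hadj u) (Submodule.mem_span_singleton_self _)
    have h5 := Submodule.finrank_add_le_finrank_add_finrank (LinearMap.range dv)
      (Submodule.span (ZMod 2) {(Pi.single r 1 : V → ZMod 2)})
    rw [htop, finrank_top, Module.finrank_fintype_fun_eq_card] at h5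
    have h6 : Module.finrank (ZMod 2) (Submodule.span (ZMod 2) {(Pi.single r 1 : V → ZMod 2)}) ≤ 1 :=
      my_finrank_span_le _
    omega
  have hF : Module.finrank (ZMod 2) (LinearMap.ker bd) ≤ 1 := by
    have hle : LinearMap.ker bd ≤ Submodule.span (ZMod 2) {(fun _ => 1 : Q → ZMod 2)} := by
      intro h hh
      rw [LinearMap.mem_ker] at hh
      have h1 : ∀ d, h (Quotient.mk _ d) = h (Quotient.mk _ (Dart.symm d)) := by
        intro d
        have := hbd h d
        rw [hh] at this
        exact (CharTwo.add_eq_zero.mp this.symm)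
      have h2 : ∀ d, h (Quotient.mk _ (σ d)) = h (Quotient.mk _ d) := by
        intro d
        rw [h1 d, quot_symm_eq]
      have h2' : ∀ d d' : G.Dart, d.fst = d'.fst →
          h (Quotient.mk _ d) = h (Quotient.mk _ d') := by
        intro d d' hd
        obtain ⟨n, rfl⟩ := (hT.rot.orbit_eq d d' hd).exists_nat_pow_eq
        clear hd
        induction n with
        | zero => rfl
        | succ n ih => rw [pow_succ', Equiv.Perm.mul_apply, h2, ih]
      have h3 : ∀ a b, G.Reachable a b → ∀ d d' : G.Dart, d.fst = a → d'.fst = b →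
          h (Quotient.mk _ d) = h (Quotient.mk _ d') := by
        intro a b hab
        rw [SimpleGraph.reachable_iff_reflTransGen] at hab
        induction hab using Relation.ReflTransGen.head_induction_on with
        | refl => intro d d' h1 h2; exact h2' _ _ (h1.trans h2.symm)
        | head hab _ ih =>
          rename_i a b' _
          intro d d' hd hd'
          let d0 : G.Dart := ⟨(a, b'), hab⟩
          rw [h2' d d0 hd, h1 d0]
          exact ih _ _ rfl hd'
      rw [Submodule.mem_span_singleton]
      by_cases hne : Nonempty G.Dart
      · obtain ⟨d0⟩ := hne
        refine ⟨h (Quotient.mk _ d0), ?_⟩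
        funext q
        induction q using Quotient.ind with
        | _ d =>
          simp only [Pi.smul_apply, smul_eq_mul, mul_one]
          exact h3 _ _ (hT.connected.preconnected _ _) d0 d rfl rfl
      · refine ⟨0, ?_⟩
        funext q
        induction q using Quotient.ind with
        | _ d => exact absurd ⟨d⟩ hne
    exact (Submodule.finrank_mono hle).trans (my_finrank_span_le _)
  have hr1 := LinearMap.finrank_range_add_finrank_ker bd
  have hr2 := LinearMap.finrank_range_add_finrank_ker dv
  rw [Module.finrank_fintype_fun_eq_card] at hr1 hr2
  have heu := hT.euler
  rw [numFaces, Nat.card_eq_fintype_card (α := G.edgeSet), ← hQ,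
    Nat.card_eq_fintype_card (α := Q)] at heu
  have heq : LinearMap.range bd = LinearMap.ker dv := by
    apply Submodule.eq_of_le_of_finrank_le hcomp
    omega
  have hmem : e ∈ LinearMap.range bd := by
    rw [heq, LinearMap.mem_ker]
    funext u
    exact he u
  obtain ⟨h, rfl⟩ := hmem
  refine ⟨fun d => h (Quotient.mk _ d), fun d => ?_, fun d => hbd h d⟩
  simp only [quot_symm_eq]

/-- Connected sets carry mod 2 paths. -/
lemma path_chain (G : SimpleGraph V) [Fintype G.Dart] [DecidableEq V] (A : Set V) (a b : V)
    (hab : Relation.ReflTransGen (fun p q => G.Adj p q ∧ p ∈ A ∧ q ∈ A) a b) :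
    ∃ e : G.edgeSet → ZMod 2,
      (∀ d : G.Dart, (d.fst ∉ A ∨ d.snd ∉ A) → e ⟨d.edge, d.edge_mem⟩ = 0) ∧
      ∀ u : V, ∑ d : G.Dart, (if d.fst = u then e ⟨d.edge, d.edge_mem⟩ else 0) =
        (if a = u then 1 else 0) + (if b = u then 1 else 0) := by
  induction hab with
  | refl =>
    refine ⟨fun _ => 0, fun _ _ => rfl, fun u => ?_⟩
    simp [CharTwo.add_self_eq_zero]
  | tail _ hbc ih =>
    rename_i b c _
    obtain ⟨e, he1, he2⟩ := ih
    obtain ⟨hadj, hb, hc⟩ := hbc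
    refine ⟨fun x => e x + (if x.1 = s(b, c) then 1 else 0), fun d hd => ?_, fun u => ?_⟩
    · simp only [he1 d hd, zero_add]
      rw [if_neg]
      intro h
      have h' : s(d.fst, d.snd) = s(b, c) := h
      rw [Sym2.eq_iff] at h'
      rcases h' with ⟨h1, h2⟩ | ⟨h1, h2⟩ <;> rw [h1, h2] at hd <;> tauto
    · have : ∀ d : G.Dart, (if d.fst = u then
          (e ⟨d.edge, d.edge_mem⟩ + (if d.edge = s(b, c) then (1 : ZMod 2) else 0)) else 0) =
          (if d.fst = u then e ⟨d.edge, d.edge_mem⟩ else 0) +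
          (if d.fst = u then (if d.edge = s(b, c) then (1 : ZMod 2) else 0) else 0) := by
        intro d; split_ifs <;> simp
      rw [Finset.sum_congr rfl fun d _ => this d, Finset.sum_add_distrib, he2 u,
        single_edge_div hadj u]
      generalize (if a = u then (1 : ZMod 2) else 0) = p
      generalize (if b = u then (1 : ZMod 2) else 0) = q
      generalize (if c = u then (1 : ZMod 2) else 0) = r
      revert p q r; decide

/-- Combinatorial Jordan curve lemma: two disjoint connected sets avoiding `x` cannot cross
at `x`. -/
lemma no_crossing [Fintype V] (G : SimpleGraph V) (σ : Equiv.Perm G.Dart)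
    (hT : IsPlaneTriangulation G σ) (d0 : G.Dart) (m : ℕ)
    (hinj : ∀ i j : ℕ, i < m → j < m → (σ ^ i) d0 = (σ ^ j) d0 → i = j)
    (t1 t2 t3 t4 : ℕ) (h12 : t1 < t2) (h23 : t2 < t3) (h34 : t3 < t4) (h4 : t4 < m)
    (A B : Set V) (hAB : Disjoint A B) (hxA : d0.fst ∉ A) (hxB : d0.fst ∉ B)
    (hA : Relation.ReflTransGen (fun p q => G.Adj p q ∧ p ∈ A ∧ q ∈ A)
      ((σ ^ t1) d0).snd ((σ ^ t3) d0).snd)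
    (hB : Relation.ReflTransGen (fun p q => G.Adj p q ∧ p ∈ B ∧ q ∈ B)
      ((σ ^ t2) d0).snd ((σ ^ t4) d0).snd)
    (hB2 : ((σ ^ t2) d0).snd ∈ B) (hB4 : ((σ ^ t4) d0).snd ∈ B) : False := by
  classical
  have : Fintype G.Dart := Fintype.ofFinite _
  have hfst : ∀ t, ((σ ^ t) d0).fst = d0.fst := by
    intro t
    induction t with
    | zero => rfl
    | succ n ih => rw [pow_succ', Equiv.Perm.mul_apply, hT.rot.fst_eq, ih]
  set x := d0.fst with hx
  set y1 := ((σ ^ t1) d0).snd with hy1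
  set y3 := ((σ ^ t3) d0).snd with hy3
  have hadj1 : G.Adj x y1 := by have := ((σ ^ t1) d0).adj; rwa [hfst] at this
  have hadj3 : G.Adj x y3 := by have := ((σ ^ t3) d0).adj; rwa [hfst] at this
  obtain ⟨e, he1, he2⟩ := path_chain G A y1 y3 hA
  obtain ⟨h, hh1, hh2⟩ := cycle_bounds G σ hT
    (fun z => e z + (if z.1 = s(x, y1) then 1 else 0) + (if z.1 = s(x, y3) then 1 else 0)) (by
      intro u
      have : ∀ d : G.Dart, (if d.fst = u then
          (e ⟨d.edge, d.edge_mem⟩ + (if d.edge = s(x, y1) then (1 : ZMod 2) else 0)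
            + (if d.edge = s(x, y3) then (1 : ZMod 2) else 0)) else 0) =
          (if d.fst = u then e ⟨d.edge, d.edge_mem⟩ else 0) +
          (if d.fst = u then (if d.edge = s(x, y1) then (1 : ZMod 2) else 0) else 0) +
          (if d.fst = u then (if d.edge = s(x, y3) then (1 : ZMod 2) else 0) else 0) := by
        intro d; split_ifs <;> simp
      rw [Finset.sum_congr rfl fun d _ => this d, Finset.sum_add_distrib,
        Finset.sum_add_distrib, he2 u, single_edge_div hadj1 u, single_edge_div hadj3 u]
      generalize (if y1 = u then (1 : ZMod 2) else 0) = p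
      generalize (if y3 = u then (1 : ZMod 2) else 0) = q
      generalize (if x = u then (1 : ZMod 2) else 0) = r
      revert p q r; decide)
  simp only at hh2
  -- darts equal to a given dart out of `x`
  have hext : ∀ d d' : G.Dart, d.fst = d'.fst → d.snd = d'.snd → d = d' := by
    intro d d' h1 h2
    exact Dart.ext _ _ (Prod.ext h1 h2)
  have hAne1 : y1 ∈ A ∨ y1 = y3 := by
    rcases Relation.ReflTransGen.cases_head hA with h | ⟨c, hc, _⟩
    · exact Or.inr h
    · exact Or.inl hc.2.1
  have hAne3 : y3 ∈ A ∨ y1 = y3 := by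
    rcases Relation.ReflTransGen.cases_tail hA with h | ⟨c, _, hc⟩
    · exact Or.inr h.symm
    · exact Or.inl hc.2.2
  have hne13 : y1 ≠ y3 := by
    intro h
    have : (σ ^ t1) d0 = (σ ^ t3) d0 := hext _ _ (by rw [hfst, hfst]) h
    have := hinj t1 t3 (by omega) (by omega) this
    omega
  have hy1A : y1 ∈ A := hAne1.resolve_right hne13
  have hy3A : y3 ∈ A := hAne3.resolve_right hne13
  -- the chain vanishes away from `A ∪ {x}`
  have hzero : ∀ d : G.Dart, d.fst ∈ B → h d = h d.symm := by
    intro d hd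
    have hdA : d.fst ∉ A := fun h => Set.disjoint_left.mp hAB h hd
    have hdx : d.fst ≠ x := fun h => hxB (h ▸ hd)
    have h2 := hh2 d
    rw [he1 d (Or.inl hdA), if_neg, if_neg] at h2
    · simp only [add_zero] at h2
      exact CharTwo.add_eq_zero.mp h2.symm
    · intro h3
      have h' : s(d.fst, d.snd) = s(x, y3) := h3
      rw [Sym2.eq_iff] at h'
      rcases h' with ⟨h1, _⟩ | ⟨h1, _⟩
      · exact hdx h1
      · exact hdA (h1 ▸ hy3A)
    · intro h3
      have h' : s(d.fst, d.snd) = s(x, y1) := h3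
      rw [Sym2.eq_iff] at h'
      rcases h' with ⟨h1, _⟩ | ⟨h1, _⟩
      · exact hdx h1
      · exact hdA (h1 ▸ hy1A)
  have hconst : ∀ d d' : G.Dart, d.fst ∈ B → d.fst = d'.fst → h d = h d' := by
    intro d d' hd hdd
    obtain ⟨n, rfl⟩ := (hT.rot.orbit_eq d d' hdd).exists_nat_pow_eq
    clear hdd
    have hf : ∀ n, ((σ ^ n) d).fst = d.fst := by
      intro t
      induction t with
      | zero => rfl
      | succ n ih => rw [pow_succ', Equiv.Perm.mul_apply, hT.rot.fst_eq, ih]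
    induction n with
    | zero => rfl
    | succ n ih =>
      rw [pow_succ', Equiv.Perm.mul_apply, hh1, ← hzero _ (by rw [hf]; exact hd), ih]
  have hBconst : ∀ p q, Relation.ReflTransGen (fun p q => G.Adj p q ∧ p ∈ B ∧ q ∈ B) p q →
      p ∈ B → ∀ d d' : G.Dart, d.fst = p → d'.fst = q → h d = h d' := by
    intro p q hpq hp
    induction hpq with
    | refl => intro d d' h1 h2; exact hconst d d' (h1 ▸ hp) (h1.trans h2.symm)
    | tail _ hbc ih =>
      rename_i b c _
      intro d d' hd hd'
      obtain ⟨hadj, hb, hc⟩ := hbc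
      let f : G.Dart := ⟨(b, c), hadj⟩
      rw [ih d f hd rfl, hzero f hb]
      exact hconst _ _ hc hd'.symm
  have h24 : h ((σ ^ t2) d0) = h ((σ ^ t4) d0) := by
    have e2 := hzero ((σ ^ t2) d0).symm hB2
    have e4 := hzero ((σ ^ t4) d0).symm hB4
    rw [Dart.symm_symm] at e2 e4
    rw [← e2, ← e4]
    exact hBconst _ _ hB hB2 _ _ rfl rfl
  -- rotating around `x`
  have hstep : ∀ t, t < m → h ((σ ^ (t + 1)) d0) = h ((σ ^ t) d0) +
      ((if t = t1 then 1 else 0) + (if t = t3 then 1 else 0)) := by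
    intro t ht
    have key : ∀ s, s < m → ((((σ ^ t) d0).edge = s(x, ((σ ^ s) d0).snd)) ↔ t = s) := by
      intro s hs
      constructor
      · intro h3
        have h' : s(((σ ^ t) d0).fst, ((σ ^ t) d0).snd) = s(x, ((σ ^ s) d0).snd) := h3
        rw [Sym2.eq_iff] at h'
        have h5 : ((σ ^ t) d0).snd = ((σ ^ s) d0).snd := by
          rcases h' with ⟨_, h2⟩ | ⟨_, h2⟩
          · exact h2
          · exfalso
            have := ((σ ^ t) d0).adj
            rw [hfst, h2] at this
            exact G.irrefl this
        exact hinj t s ht hs (hext _ _ (by rw [hfst, hfst]) h5)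
      · rintro rfl
        change s(((σ ^ t) d0).fst, ((σ ^ t) d0).snd) = _
        rw [hfst]
    have h2 := hh2 ((σ ^ t) d0)
    rw [he1 _ (Or.inl (by rw [hfst]; exact hxA))] at h2
    simp only [hy1, hy3, key t1 (by omega), key t3 (by omega)] at h2
    rw [pow_succ', Equiv.Perm.mul_apply, hh1]
    generalize h ((σ ^ t) d0) = p at *
    generalize h ((σ ^ t) d0).symm = q at *
    generalize (if t = t1 then (1 : ZMod 2) else 0) = r at *
    generalize (if t = t3 then (1 : ZMod 2) else 0) = w at *
    clear * - h2
    revert p q r w; decide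
  have hrun : ∀ t, t2 ≤ t → t ≤ t4 → h ((σ ^ t) d0) = h ((σ ^ t2) d0) +
      (if t3 < t then 1 else 0) := by
    intro t ht
    induction t, ht using Nat.le_induction with
    | base => intro _; rw [if_neg (by omega), add_zero]
    | succ n hn ih =>
      intro hn4
      rw [hstep n (by omega), ih (by omega), if_neg (show n ≠ t1 by omega), zero_add]
      rcases lt_trichotomy n t3 with h5 | h5 | h5
      · rw [if_neg (by omega), if_neg (by omega), if_neg (by omega)]; simp
      · rw [if_neg (by omega), if_pos h5, if_pos (by omega)]; simp
      · rw [if_pos h5, if_neg (by omega), if_pos (by omega)]; simp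
  have := hrun t4 (by omega) le_rfl
  rw [if_pos h34, ← h24] at this
  generalize h ((σ ^ t2) d0) = p at this
  revert p; decide

/-- The subgraph induced on `S` is 4-colorable. -/
def Ext4 (G : SimpleGraph V) (S : Set V) : Prop :=
  ∃ c : V → Fin 4, ∀ u ∈ S, ∀ w ∈ S, G.Adj u w → c u ≠ c w

lemma ext4_free (G : SimpleGraph V) (S : Set V) (x : V) (hx : x ∉ S) (c : V → Fin 4)
    (hc : ∀ u ∈ S, ∀ w ∈ S, G.Adj u w → c u ≠ c w) (p : Fin 4)
    (hp : ∀ u ∈ S, G.Adj x u → c u ≠ p) : Ext4 G (insert x S) := by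
  classical
  refine ⟨Function.update c x p, ?_⟩
  have hne : ∀ u ∈ S, u ≠ x := fun u hu h => hx (h ▸ hu)
  intro u hu w hw huw
  rcases hu with rfl | hu <;> rcases hw with rfl | hw
  · exact absurd huw (G.irrefl)
  · rw [Function.update_self, Function.update_of_ne (hne w hw)]
    exact (hp w hw huw).symm
  · rw [Function.update_self, Function.update_of_ne (hne u hu)]
    exact hp u hu huw.symm
  · rw [Function.update_of_ne (hne w hw), Function.update_of_ne (hne u hu)]
    exact hc u hu w hw huw

/-- A Kempe exchange. -/
lemma kempe_swap (G : SimpleGraph V) (S : Set V) (x : V) (hx : x ∉ S) (c : V → Fin 4)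
    (hc : ∀ u ∈ S, ∀ w ∈ S, G.Adj u w → c u ≠ c w) (y : Fin 4 → V)
    (hyc : ∀ p, c (y p) = p)
    (hy : ∀ u ∈ S, G.Adj x u → u = y (c u)) (p q : Fin 4) (hpq : p ≠ q)
    (hno : ¬ Relation.ReflTransGen (fun a b => G.Adj a b ∧ a ∈ {u | u ∈ S ∧ (c u = p ∨ c u = q)} ∧
      b ∈ {u | u ∈ S ∧ (c u = p ∨ c u = q)}) (y p) (y q)) : Ext4 G (insert x S) := by
  classical
  set R := (fun a b => G.Adj a b ∧ a ∈ {u | u ∈ S ∧ (c u = p ∨ c u = q)} ∧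
      b ∈ {u | u ∈ S ∧ (c u = p ∨ c u = q)}) with hR
  let C : Set V := {u | Relation.ReflTransGen R (y p) u}
  have hCcol : ∀ u ∈ C, c u = p ∨ c u = q := by
    intro u hu
    rcases Relation.ReflTransGen.cases_tail hu with h | ⟨b, _, hb⟩
    · left; rw [h, hyc]
    · exact hb.2.2.2
  have hCadj : ∀ u ∈ C, u ∈ S → ∀ w ∈ S, G.Adj u w → (c w = p ∨ c w = q) → w ∈ C := by
    intro u hu huS w hw huw hcw
    exact Relation.ReflTransGen.tail hu ⟨huw, ⟨huS, hCcol u hu⟩, ⟨hw, hcw⟩⟩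
  let c' : V → Fin 4 := fun u => if u ∈ C then Equiv.swap p q (c u) else c u
  refine ext4_free G S x hx c' ?_ p ?_
  · intro u hu w hw huw
    have h1 := hc u hu w hw huw
    by_cases huC : u ∈ C <;> by_cases hwC : w ∈ C
    · simp only [c', if_pos huC, if_pos hwC]
      exact fun h => h1 ((Equiv.swap p q).injective h)
    · simp only [c', if_pos huC, if_neg hwC]
      have h2 : ¬ (c w = p ∨ c w = q) := fun h => hwC (hCadj u huC hu w hw huw h)
      push Not at h2
      rcases hCcol u huC with h3 | h3
      · rw [h3, Equiv.swap_apply_left]; exact h2.2.symm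
      · rw [h3, Equiv.swap_apply_right]; exact h2.1.symm
    · simp only [c', if_neg huC, if_pos hwC]
      have h2 : ¬ (c u = p ∨ c u = q) := fun h => huC (hCadj w hwC hw u hu huw.symm h)
      push Not at h2
      rcases hCcol w hwC with h3 | h3
      · rw [h3, Equiv.swap_apply_left]; exact h2.2
      · rw [h3, Equiv.swap_apply_right]; exact h2.1
    · simp only [c', if_neg huC, if_neg hwC]
      exact h1
  · intro u hu hxu
    have huy := hy u hu hxu
    have hypC : y p ∈ C := Relation.ReflTransGen.refl
    have hyqC : y q ∉ C := hno
    by_cases huC : u ∈ C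
    · simp only [c', if_pos huC]
      rcases hCcol u huC with h3 | h3
      · rw [h3, Equiv.swap_apply_left]; exact hpq.symm
      · rw [h3] at huy
        exact absurd (huy ▸ huC) hyqC
    · simp only [c', if_neg huC]
      intro h3
      rw [h3] at huy
      exact huC (huy ▸ hypC)

/-- In a plane triangulation a 4-coloring of an induced subgraph extends to any further vertex
with at most 4 colored neighbors. -/
lemma kempe [Fintype V] (G : SimpleGraph V) (σ : Equiv.Perm G.Dart)
    (hT : IsPlaneTriangulation G σ) (S : Set V) (x : V) (hx : x ∉ S)
    (hdeg : (G.neighborSet x ∩ S).ncard ≤ 4) (hS : Ext4 G S) : Ext4 G (insert x S) := by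
  classical
  obtain ⟨c, hc⟩ := hS
  by_cases hfree : ∃ p, ∀ u ∈ S, G.Adj x u → c u ≠ p
  · obtain ⟨p, hp⟩ := hfree
    exact ext4_free G S x hx c hc p hp
  push Not at hfree
  choose y hyS hyx hyc using hfree
  have hyinj : Function.Injective y := by
    intro p q h
    rw [← hyc p, ← hyc q, h]
  have hrange : Set.range y = G.neighborSet x ∩ S := by
    apply Set.eq_of_subset_of_ncard_le
    · rintro _ ⟨p, rfl⟩
      exact ⟨hyx p, hyS p⟩
    · rw [Set.ncard_range_of_injective hyinj]
      simpa using hdeg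
    · exact Set.toFinite _
  have hy : ∀ u ∈ S, G.Adj x u → u = y (c u) := by
    intro u hu hxu
    have : u ∈ Set.range y := by rw [hrange]; exact ⟨hxu, hu⟩
    obtain ⟨p, rfl⟩ := this
    rw [hyc]
  let d0 : G.Dart := ⟨(x, y 0), hyx 0⟩
  obtain ⟨_, hinj, hsurj⟩ := orbit_card_facts σ d0 _ rfl
  set m := Nat.card {e : G.Dart // σ.SameCycle d0 e} with hm
  have hex : ∀ p : Fin 4, ∃ i, i < m ∧ (σ ^ i) d0 = ⟨(x, y p), hyx p⟩ := by
    intro p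
    exact hsurj _ (hT.rot.orbit_eq _ _ rfl)
  choose t htm ht using hex
  have htinj : Function.Injective t := by
    intro p q h
    have h1 := ht p
    rw [h, ht q] at h1
    have h2 : y q = y p := congrArg (fun d : G.Dart => d.snd) h1
    exact hyinj h2.symm
  let τ := Tuple.sort t
  have hmono : StrictMono (t ∘ τ) :=
    (Tuple.monotone_sort t).strictMono_of_injective (htinj.comp τ.injective)
  by_contra hcon
  have hA := fun p q hpq => not_not.mp (mt (kempe_swap G S x hx c hc y hyc hy p q hpq) hcon)
  have h02 := hA (τ 0) (τ 2) (fun h => absurd (τ.injective h) (by decide))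
  have h13 := hA (τ 1) (τ 3) (fun h => absurd (τ.injective h) (by decide))
  have hsnd : ∀ p, ((σ ^ t p) d0).snd = y p := by
    intro p; rw [ht p]
  rw [← hsnd (τ 0), ← hsnd (τ 2)] at h02
  rw [← hsnd (τ 1), ← hsnd (τ 3)] at h13
  refine no_crossing G σ hT d0 m hinj (t (τ 0)) (t (τ 1)) (t (τ 2)) (t (τ 3))
    (hmono (by decide)) (hmono (by decide)) (hmono (by decide)) (htm _) _ _ ?_ ?_ ?_ h02 h13 ?_ ?_
  · rw [Set.disjoint_left]
    rintro u ⟨_, h1⟩ ⟨_, h2⟩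
    have n1 : τ 0 ≠ τ 1 := fun h => absurd (τ.injective h) (by decide)
    have n2 : τ 0 ≠ τ 3 := fun h => absurd (τ.injective h) (by decide)
    have n3 : τ 2 ≠ τ 1 := fun h => absurd (τ.injective h) (by decide)
    have n4 : τ 2 ≠ τ 3 := fun h => absurd (τ.injective h) (by decide)
    rcases h1 with h1 | h1 <;> rw [h1] at h2 <;> tauto
  · exact fun h => hx h.1
  · exact fun h => hx h.1
  · rw [hsnd]; exact ⟨hyS _, Or.inl (hyc _)⟩
  · rw [hsnd]; exact ⟨hyS _, Or.inr (hyc _)⟩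

lemma kempe' [Fintype V] (G : SimpleGraph V) (σ : Equiv.Perm G.Dart)
    (hT : IsPlaneTriangulation G σ) (S : Set V) (x : V) (hx : x ∉ S) (M : Finset V)
    (hM : ∀ u ∈ M, G.Adj x u ∧ u ∉ S) (hdeg : deg G x ≤ 4 + M.card)
    (hS : Ext4 G S) : Ext4 G (insert x S) := by
  classical
  apply kempe G σ hT S x hx _ hS
  have h1 : deg G x = (G.neighborSet x).ncard := rfl
  have h2 : Disjoint (G.neighborSet x ∩ S) (M : Set V) := by
    rw [Set.disjoint_left]
    exact fun u hu hu' => (hM u hu').2 hu.2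
  have h3 := Set.ncard_union_eq h2
  have h4 : ((G.neighborSet x ∩ S) ∪ (M : Set V)).ncard ≤ (G.neighborSet x).ncard := by
    apply Set.ncard_le_ncard _ (Set.toFinite _)
    rintro u (hu | hu)
    · exact hu.1
    · exact (hM u hu).1
  rw [Set.ncard_coe_finset] at h3
  omega

/-- The link of a vertex of degree 5 is a 5-cycle. -/
lemma link5 [Fintype V] (G : SimpleGraph V) (σ : Equiv.Perm G.Dart)
    (hT : IsPlaneTriangulation G σ) (v : V) (hv : deg G v = 5) :
    ∃ u : Fin 5 → V, Function.Injective u ∧ (∀ w, G.Adj v w ↔ ∃ i, u i = w) ∧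
      ∀ i, G.Adj (u i) (u (i + 1)) := by
  classical
  have hne : Nonempty (G.neighborSet v) := by
    by_contra h
    rw [not_nonempty_iff] at h
    rw [deg, Nat.card_of_isEmpty] at hv
    omega
  obtain ⟨w0, hw0⟩ := hne
  let d0 : G.Dart := ⟨(v, w0), hw0⟩
  have hf : ∀ n, ((σ ^ n) d0).fst = v := by
    intro t
    induction t with
    | zero => rfl
    | succ n ih => rw [pow_succ', Equiv.Perm.mul_apply, hT.rot.fst_eq, ih]
  have hcard : Nat.card {e : G.Dart // σ.SameCycle d0 e} = 5 := by
    rw [← hv, deg]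
    refine Nat.card_congr (Equiv.ofBijective (fun e => (⟨e.1.snd, ?_⟩ : G.neighborSet v)) ⟨?_, ?_⟩)
    · obtain ⟨n, hn⟩ := e.2.exists_nat_pow_eq
      have h1 := e.1.adj
      have h2 := hf n
      rw [hn] at h2
      rw [h2] at h1
      exact h1
    · rintro ⟨e, he⟩ ⟨e', he'⟩ h
      obtain ⟨n, rfl⟩ := he.exists_nat_pow_eq
      obtain ⟨n', rfl⟩ := he'.exists_nat_pow_eq
      apply Subtype.ext
      have h2 := congrArg Subtype.val h
      exact Dart.ext _ _ (Prod.ext ((hf n).trans (hf n').symm) h2)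
    · rintro ⟨w, hw⟩
      exact ⟨⟨⟨(v, w), hw⟩, hT.rot.orbit_eq _ _ rfl⟩, rfl⟩
  obtain ⟨h5, hinj, hsurj⟩ := orbit_card_facts σ d0 5 hcard
  have htri : ∀ d : G.Dart, G.Adj d.snd (σ d).snd := by
    intro d
    have h3 := (orbit_card_facts (facePerm σ) d.symm 3 (hT.face_size_eq _)).1
    have e1 : facePerm σ d.symm = σ d := by rw [facePerm_apply, Dart.symm_symm]
    rw [pow_succ', pow_succ', pow_one, Equiv.Perm.mul_apply, Equiv.Perm.mul_apply, e1] at h3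
    set g := facePerm σ (σ d) with hg
    have hg1 : g.fst = (σ d).snd := by
      rw [hg, facePerm_apply, hT.rot.fst_eq]; rfl
    have hg2 : g.snd = d.snd := by
      have : (facePerm σ g).fst = g.snd := by
        rw [facePerm_apply, hT.rot.fst_eq]; rfl
      rw [← this, h3]; rfl
    have := g.adj
    rw [hg1, hg2] at this
    exact this.symm
  refine ⟨fun i => ((σ ^ (i : ℕ)) d0).snd, ?_, ?_, ?_⟩
  · intro i j h
    have : (σ ^ (i : ℕ)) d0 = (σ ^ (j : ℕ)) d0 :=
      Dart.ext _ _ (Prod.ext ((hf _).trans (hf _).symm) h)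
    exact Fin.ext (hinj _ _ i.2 j.2 this)
  · intro w
    constructor
    · intro hw
      obtain ⟨i, hi, hi'⟩ := hsurj ⟨(v, w), hw⟩ (hT.rot.orbit_eq _ _ rfl)
      exact ⟨⟨i, hi⟩, by simp only [hi']⟩
    · rintro ⟨i, rfl⟩
      have := ((σ ^ (i : ℕ)) d0).adj
      rwa [hf] at this
  · intro i
    have h1 := htri ((σ ^ (i : ℕ)) d0)
    rw [← Equiv.Perm.mul_apply, ← pow_succ'] at h1
    have h2 : (σ ^ ((i + 1 : Fin 5) : ℕ)) d0 = (σ ^ ((i : ℕ) + 1)) d0 := by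
      fin_cases i <;> first | rfl | exact h5.symm
    simp only [h2]
    exact h1

/-- Number of cyclic neighbors of `i` in `A`. -/
def cnb (A : Finset (Fin 5)) (i : Fin 5) : ℕ := (({i - 1, i + 1} : Finset (Fin 5)).filter (· ∈ A)).card

lemma cnb_le (A : Finset (Fin 5)) (i : Fin 5) : cnb A i ≤ 2 :=
  (Finset.card_filter_le _ _).trans Finset.card_le_two

lemma comb_path (P : Finset (Fin 5) → Prop) (b : Fin 5 → ℕ) (h0 : P ∅)
    (step : ∀ A i, i ∉ A → b i + cnb A i ≤ 7 → P A → P (insert i A))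
    (j s : Fin 5) (hsj : s ≠ j) (hs : b s ≤ 7) (hb : ∀ i, i ≠ s → i ≠ j → b i ≤ 6) :
    P (Finset.univ.erase j) := by
  have run : ∀ x2 x3 x4 : Fin 5, x2 ≠ s → x2 ≠ j → x3 ≠ s → x3 ≠ j → x4 ≠ s → x4 ≠ j →
      x2 ∉ ({s} : Finset (Fin 5)) → x3 ∉ ({x2, s} : Finset (Fin 5)) →
      x4 ∉ ({x3, x2, s} : Finset (Fin 5)) →
      cnb {s} x2 ≤ 1 → cnb {x2, s} x3 ≤ 1 → cnb {x3, x2, s} x4 ≤ 1 →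
      P ({x4, x3, x2, s} : Finset (Fin 5)) := by
    intro x2 x3 x4 a2 b2 a3 b3 a4 b4 n2 n3 n4 c2 c3 c4
    have e0 : cnb ∅ s = 0 := by simp [cnb]
    have p1 : P {s} := by
      have := step ∅ s (by simp) (by omega) h0
      simpa using this
    have p2 := step {s} x2 n2 (by have := hb x2 a2 b2; omega) p1
    have p3 := step _ x3 n3 (by have := hb x3 a3 b3; omega) p2
    exact step _ x4 n4 (by have := hb x4 a4 b4; omega) p3
  have hex : ∀ j s : Fin 5, s ≠ j → s = j + 1 ∨ s = j + 2 ∨ s = j + 3 ∨ s = j + 4 := by decide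
  rcases hex j s hsj with rfl | rfl | rfl | rfl
  · have heq : ∀ j : Fin 5, ({j + 4, j + 3, j + 2, j + 1} : Finset (Fin 5)) =
        Finset.univ.erase j := by decide
    rw [← heq j]
    apply run <;> (clear * -; revert j; decide)
  · have heq : ∀ j : Fin 5, ({j + 4, j + 3, j + 1, j + 2} : Finset (Fin 5)) =
        Finset.univ.erase j := by decide
    rw [← heq j]
    apply run <;> (clear * -; revert j; decide)
  · have heq : ∀ j : Fin 5, ({j + 4, j + 1, j + 2, j + 3} : Finset (Fin 5)) =
        Finset.univ.erase j := by decide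
    rw [← heq j]
    apply run <;> (clear * -; revert j; decide)
  · have heq : ∀ j : Fin 5, ({j + 1, j + 2, j + 3, j + 4} : Finset (Fin 5)) =
        Finset.univ.erase j := by decide
    rw [← heq j]
    apply run <;> (clear * -; revert j; decide)

lemma comb_cycle (P : Finset (Fin 5) → Prop) (b : Fin 5 → ℕ) (h0 : P ∅)
    (step : ∀ A i, i ∉ A → b i + cnb A i ≤ 7 → P A → P (insert i A))
    (p q : Fin 5) (hpq : q ≠ p) (hp : b p ≤ 7) (hq : b q ≤ 6)
    (hb : ∀ i, i ≠ p → i ≠ q → b i ≤ 5) : P Finset.univ := by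
  have e0 : cnb ∅ p = 0 := by simp [cnb]
  have p1 : P {p} := by
    have := step ∅ p (by simp) (by omega) h0
    simpa using this
  have e1 : ∀ p q : Fin 5, cnb {p} q ≤ 1 := by decide
  have p2 : P {q, p} := step {p} q (by simpa using hpq) (by have := e1 p q; omega) p1
  have hall : ∀ T : Finset (Fin 5), P ({q, p} ∪ T) := by
    intro T
    induction T using Finset.induction_on with
    | empty => simpa using p2
    | insert a T _ ih =>
      rw [Finset.union_insert]
      by_cases ha : a ∈ ({q, p} ∪ T : Finset (Fin 5))
      · rw [Finset.insert_eq_of_mem ha]; exact ih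
      · refine step _ a ha ?_ ih
        have h1 : a ≠ p := by rintro rfl; simp at ha
        have h2 : a ≠ q := by rintro rfl; simp at ha
        have := hb a h1 h2
        have := cnb_le ({q, p} ∪ T) a
        omega
  simpa using hall Finset.univ

lemma pick_pq (d : Fin 5 → ℕ) (h9 : ∀ i, d i ≤ 8)
    (h8 : (Finset.univ.filter fun i => 8 ≤ d i).card < 2)
    (h7 : (Finset.univ.filter fun i => 7 ≤ d i).card < 3) :
    ∃ p q : Fin 5, q ≠ p ∧ d p ≤ 8 ∧ d q ≤ 7 ∧ ∀ i, i ≠ p → i ≠ q → d i ≤ 6 := by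
  obtain ⟨p, _, hp⟩ := Finset.exists_max_image Finset.univ d ⟨0, Finset.mem_univ _⟩
  obtain ⟨q, hq, hq'⟩ := Finset.exists_max_image (Finset.univ.erase p) d
    ⟨p + 1, by clear * -; revert p; decide⟩
  have hqp : q ≠ p := (Finset.mem_erase.mp hq).1
  refine ⟨p, q, hqp, h9 p, ?_, ?_⟩
  · by_contra hcon
    have hp1 := hp q (Finset.mem_univ _)
    have : ({p, q} : Finset (Fin 5)) ⊆ Finset.univ.filter fun i => 8 ≤ d i := by
      intro i hi
      simp only [Finset.mem_insert, Finset.mem_singleton] at hi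
      simp only [Finset.mem_filter, Finset.mem_univ, true_and]
      rcases hi with rfl | rfl <;> omega
    have := Finset.card_le_card this
    rw [Finset.card_pair hqp.symm] at this
    omega
  · intro i hip hiq
    by_contra hcon
    have hp1 := hp q (Finset.mem_univ _)
    have hq1 := hq' i (Finset.mem_erase.mpr ⟨hip, Finset.mem_univ _⟩)
    have : ({i, p, q} : Finset (Fin 5)) ⊆ Finset.univ.filter fun i => 7 ≤ d i := by
      intro i hi
      simp only [Finset.mem_insert, Finset.mem_singleton] at hi
      simp only [Finset.mem_filter, Finset.mem_univ, true_and]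
      rcases hi with rfl | rfl | rfl <;> omega
    have := Finset.card_le_card this
    rw [Finset.card_insert_of_notMem (by simp [hip, hiq]), Finset.card_pair hqp.symm] at this
    omega

/-- An independent set of size at most `n/6` with 4-colorable complement is a forbidden class. -/
lemma no_small_class [Fintype V] (G : SimpleGraph V)
    (hno : ¬ ∃ c : V → Fin 5, Proper5 G c ∧
      ∃ k : Fin 5, 6 * Nat.card {v : V | c v = k} ≤ Fintype.card V)
    (I : Set V) (hI : ∀ a ∈ I, ∀ b ∈ I, ¬ G.Adj a b) (hcard : 6 * I.ncard ≤ Fintype.card V)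
    (hE : Ext4 G Iᶜ) : False := by
  classical
  obtain ⟨c, hc⟩ := hE
  apply hno
  refine ⟨fun u => if u ∈ I then Fin.last 4 else (c u).castSucc, ?_, Fin.last 4, ?_⟩
  · intro u w huw
    by_cases hu : u ∈ I <;> by_cases hw : w ∈ I
    · exact absurd huw (hI u hu w hw)
    · simp only [if_pos hu, if_neg hw]; exact (Fin.castSucc_ne_last _).symm
    · simp only [if_neg hu, if_pos hw]; exact Fin.castSucc_ne_last _
    · simp only [if_neg hu, if_neg hw]
      exact fun h => hc u hu w hw huw (Fin.castSucc_injective _ h)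
  · have : {v : V | (if v ∈ I then Fin.last 4 else (c v).castSucc) = Fin.last 4} = I := by
      ext u
      by_cases hu : u ∈ I
      · simp [hu]
      · simp only [Set.mem_ofPred_eq, if_neg hu, hu, iff_false]
        exact Fin.castSucc_ne_last _
    rw [this, Nat.card_coe_set_eq]
    exact hcard

theorem statement9 [Fintype V] (G : SimpleGraph V) (σ : Equiv.Perm G.Dart)
    (hG : IsMinimalCounterexample G σ) :
    ∀ v : V, deg G v = 5 →
      (∃ u : V, G.Adj v u ∧ 9 ≤ deg G u) ∨
      2 ≤ Nat.card {u : V | G.Adj v u ∧ 8 ≤ deg G u} ∨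
      3 ≤ Nat.card {u : V | G.Adj v u ∧ 7 ≤ deg G u} := by

  classical
  intro v hv
  obtain ⟨hT, hno, hmin⟩ := hG
  obtain ⟨u, huinj, hadj, hcyc⟩ := link5 G σ hT v hv
  by_contra hcon
  push Not at hcon
  obtain ⟨h9, h8, h7⟩ := hcon
  have hvu : ∀ i, G.Adj v (u i) := fun i => (hadj _).mpr ⟨i, rfl⟩
  have hvne : ∀ i, u i ≠ v := fun i h => G.irrefl (h ▸ hvu i : G.Adj v v)
  have hconv : ∀ n, Nat.card {w : V | G.Adj v w ∧ n ≤ deg G w} =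
      (Finset.univ.filter fun i => n ≤ deg G (u i)).card := by
    intro n
    have : {w : V | G.Adj v w ∧ n ≤ deg G w} =
        u '' (Finset.univ.filter fun i => n ≤ deg G (u i) : Finset (Fin 5)) := by
      ext w
      simp only [Set.mem_ofPred_eq, hadj, Set.mem_image, Finset.coe_filter, Finset.mem_univ,
        true_and]
      constructor
      · rintro ⟨⟨i, rfl⟩, h⟩; exact ⟨i, h, rfl⟩
      · rintro ⟨i, h, rfl⟩; exact ⟨⟨i, rfl⟩, h⟩
    rw [this, Nat.card_coe_set_eq, Set.ncard_image_of_injective _ huinj, Set.ncard_coe_finset]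
  rw [hconv] at h8 h7
  obtain ⟨p, q, hqp, hdp, hdq, hdo⟩ := pick_pq (fun i => deg G (u i))
    (fun i => Nat.le_of_lt_succ (h9 _ (hvu i))) h8 h7
  -- the smaller graph
  let X : Finset V := insert v (Finset.univ.image u)
  have hXcard : X.card = 6 := by
    rw [Finset.card_insert_of_notMem, Finset.card_image_of_injective _ huinj]
    · simp
    · simp only [Finset.mem_image, Finset.mem_univ, true_and, not_exists]
      exact hvne
  have hXmem : ∀ w, w ∈ X ↔ w = v ∨ ∃ i, u i = w := by
    intro w; simp [X]
  have hWcard : Fintype.card {w // w ∉ X} + 6 = Fintype.card V := by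
    rw [Fintype.card_subtype_compl, Fintype.card_coe, hXcard]
    have := Finset.card_le_univ X
    omega
  obtain ⟨c, hcprop, k, hk⟩ := hmin {w // w ∉ X} (G.comap Subtype.val)
    ⟨V, inferInstance, G, σ, hT, ⟨Subtype.val, fun h => h⟩, Subtype.val_injective⟩ (by omega)
  let I0 : Set V := Subtype.val '' {w : {w // w ∉ X} | c w = k}
  have hI0card : 6 * (I0.ncard + 1) ≤ Fintype.card V := by
    have : I0.ncard = Nat.card {w : {w // w ∉ X} | c w = k} := by
      rw [Set.ncard_image_of_injective _ Subtype.val_injective, Nat.card_coe_set_eq]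
    omega
  have hI0X : ∀ w ∈ I0, w ∉ X := by
    rintro _ ⟨w, _, rfl⟩; exact w.2
  have hI0ind : ∀ a ∈ I0, ∀ b ∈ I0, ¬ G.Adj a b := by
    rintro _ ⟨a, ha, rfl⟩ _ ⟨b, hb, rfl⟩ hab
    have h1 : c a = k := ha
    have h2 : c b = k := hb
    exact hcprop (show (G.comap Subtype.val).Adj a b from hab) (h1.trans h2.symm)
  let B : Set V := {w | w ∉ X ∧ w ∉ I0}
  have hB : Ext4 G B := by
    let f : Fin 5 → Fin 4 := fun x => if h : x ≠ k then (finSuccAboveEquiv k).symm ⟨x, h⟩ else 0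
    have hf : ∀ x y, x ≠ k → y ≠ k → f x = f y → x = y := by
      intro x y hx hy h
      simp only [f, dif_pos hx, dif_pos hy] at h
      exact congrArg Subtype.val ((finSuccAboveEquiv k).symm.injective h)
    refine ⟨fun w => if h : w ∉ X then f (c ⟨w, h⟩) else 0, ?_⟩
    rintro a ⟨haX, haI⟩ b ⟨hbX, hbI⟩ hab
    simp only [dif_pos haX, dif_pos hbX]
    intro h
    refine hcprop (show (G.comap Subtype.val).Adj ⟨a, haX⟩ ⟨b, hbX⟩ from hab) (hf _ _ ?_ ?_ h)
    · exact fun h => haI ⟨⟨a, haX⟩, h, rfl⟩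
    · exact fun h => hbI ⟨⟨b, hbX⟩, h, rfl⟩
  let has : Fin 5 → Prop := fun i => ∃ z ∈ I0, G.Adj (u i) z
  let b : Fin 5 → ℕ := fun i => deg G (u i) - (if has i then 1 else 0)
  let P : Finset (Fin 5) → Prop := fun A => Ext4 G (B ∪ u '' A)
  have huX : ∀ i, u i ∈ X := fun i => (hXmem _).mpr (Or.inr ⟨i, rfl⟩)
  have hvX : v ∈ X := (hXmem _).mpr (Or.inl rfl)
  have huS : ∀ (A : Finset (Fin 5)) i, i ∉ A → u i ∉ B ∪ u '' A := by
    rintro A i hi (h | ⟨j, hj, hji⟩)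
    · exact h.1 (huX i)
    · exact hi (huinj hji ▸ hj)
  have hvS : ∀ (A : Finset (Fin 5)), v ∉ B ∪ u '' A := by
    rintro A (h | ⟨j, hj, hji⟩)
    · exact h.1 hvX
    · exact hvne j hji
  have hI0S : ∀ (A : Finset (Fin 5)), ∀ z ∈ I0, z ∉ B ∪ u '' A := by
    rintro A z hz (h | ⟨j, hj, hji⟩)
    · exact h.2 hz
    · exact hI0X z hz (hji ▸ huX j)
  have step : ∀ A i, i ∉ A → b i + cnb A i ≤ 7 → P A → P (insert i A) := by
    intro A i hi hle hP
    have hset : B ∪ u '' (insert i A : Finset (Fin 5)) = insert (u i) (B ∪ u '' A) := by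
      rw [Finset.coe_insert, Set.image_insert_eq, Set.union_insert]
    change Ext4 G (B ∪ u '' (insert i A : Finset (Fin 5)))
    rw [hset]
    let N : Finset (Fin 5) := ({i - 1, i + 1} : Finset (Fin 5)).filter (· ∉ A)
    have hN : N.card + cnb A i = 2 := by
      have h1 := Finset.card_filter_add_card_filter_not (s := ({i - 1, i + 1} : Finset (Fin 5)))
        (fun j => j ∈ A)
      have h2 : ({i - 1, i + 1} : Finset (Fin 5)).card = 2 := by
        have h3 : ∀ i : Fin 5, ({i - 1, i + 1} : Finset (Fin 5)).card = 2 := by decide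
        exact h3 i
      rw [cnb]
      simp only [N]
      omega
    have hNadj : ∀ j ∈ N, G.Adj (u i) (u j) ∧ j ∉ A := by
      intro j hj
      simp only [N, Finset.mem_filter, Finset.mem_insert, Finset.mem_singleton] at hj
      refine ⟨?_, hj.2⟩
      rcases hj.1 with rfl | rfl
      · have := hcyc (i - 1)
        rw [sub_add_cancel] at this
        exact this.symm
      · exact hcyc i
    let M0 : Finset V := insert v (N.image u)
    have hM0 : M0.card = N.card + 1 := by
      rw [Finset.card_insert_of_notMem, Finset.card_image_of_injective _ huinj]
      simp only [Finset.mem_image, not_exists, not_and]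
      exact fun j _ => hvne j
    have hM0p : ∀ w ∈ M0, G.Adj (u i) w ∧ w ∉ B ∪ u '' A := by
      intro w hw
      simp only [M0, Finset.mem_insert, Finset.mem_image] at hw
      rcases hw with rfl | ⟨j, hj, rfl⟩
      · exact ⟨(hvu i).symm, hvS A⟩
      · exact ⟨(hNadj j hj).1, huS A j (hNadj j hj).2⟩
    by_cases hhas : has i
    · obtain ⟨z, hz, hzadj⟩ := id hhas
      have hzM : z ∉ M0 := by
        intro h
        apply hI0X z hz
        simp only [M0, Finset.mem_insert, Finset.mem_image] at h
        rcases h with rfl | ⟨j, _, rfl⟩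
        · exact hvX
        · exact huX j
      refine kempe' G σ hT _ (u i) (huS A i hi) (insert z M0) ?_ ?_ hP
      · intro w hw
        rcases Finset.mem_insert.mp hw with rfl | hw
        · exact ⟨hzadj, hI0S A _ hz⟩
        · exact hM0p w hw
      · rw [Finset.card_insert_of_notMem hzM, hM0]
        simp only [b, if_pos hhas] at hle
        omega
    · refine kempe' G σ hT _ (u i) (huS A i hi) M0 hM0p ?_ hP
      rw [hM0]
      simp only [b, if_neg hhas] at hle
      omega
  have hP0 : P ∅ := by
    change Ext4 G (B ∪ u '' ((∅ : Finset (Fin 5)) : Set (Fin 5)))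
    simpa using hB
  have hbt : ∀ i, has i → b i = deg G (u i) - 1 := fun i h => by simp only [b, if_pos h]
  have hble : ∀ i, b i ≤ deg G (u i) := fun i => Nat.sub_le _ _
  -- one new vertex in the small class
  have hfinal : ∀ x, x ∉ I0 → (∀ z ∈ I0, ¬ G.Adj x z) → Ext4 G (insert x I0)ᶜ → False := by
    intro x hx hxz hE
    refine no_small_class G hno (insert x I0) ?_ ?_ hE
    · rintro a (rfl | ha) b (rfl | hb) hab
      · exact G.irrefl hab
      · exact hxz b hb hab
      · exact hxz a ha hab.symm
      · exact hI0ind a ha b hb hab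
    · rw [Set.ncard_insert_of_notMem hx (Set.toFinite _)]
      exact hI0card
  have hpath : ∀ j s, s ≠ j → ¬ has j → b s ≤ 7 → (∀ i, i ≠ s → i ≠ j → b i ≤ 6) → False := by
    intro j s hsj hj hs hb
    have h1 : Ext4 G (B ∪ u '' (Finset.univ.erase j : Finset (Fin 5))) :=
      comb_path P b hP0 step j s hsj hs hb
    have h2 := kempe' G σ hT _ v (hvS _) {u j} (by
      intro w hw
      rw [Finset.mem_singleton] at hw
      subst hw
      exact ⟨hvu j, huS _ j (by simp)⟩) (by rw [hv]; simp) h1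
    refine hfinal (u j) (fun h => hI0X _ h (huX j)) (fun z hz h => hj ⟨z, hz, h⟩) ?_
    convert h2 using 1
    ext w
    simp only [Set.mem_compl_iff, Set.mem_insert_iff, not_or, Set.mem_union, Set.mem_image,
      Finset.coe_erase, Finset.coe_univ, Set.mem_sdiff, Set.mem_univ, true_and,
      Set.mem_singleton_iff]
    constructor
    · rintro ⟨h3, h4⟩
      by_cases h5 : w ∈ X
      · rcases (hXmem w).mp h5 with h6 | ⟨i, rfl⟩
        · exact Or.inl h6
        · exact Or.inr (Or.inr ⟨i, fun h => h3 (by rw [h]), rfl⟩)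
      · exact Or.inr (Or.inl ⟨h5, h4⟩)
    · rintro (rfl | h | ⟨i, hi, rfl⟩)
      · exact ⟨(hvne j).symm, fun h => hI0X _ h hvX⟩
      · exact ⟨fun h' => h.1 (h' ▸ huX j), h.2⟩
      · exact ⟨fun h => hi (huinj h), fun h => hI0X _ h (huX i)⟩
  by_cases hp : has p
  swap
  · refine hpath p q hqp hp ((hble q).trans hdq) fun i hi hi' => (hble i).trans (hdo i hi' hi)
  have hbp : b p ≤ 7 := by rw [hbt p hp]; exact Nat.sub_le_sub_right hdp 1
  by_cases hq : has q
  swap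
  · exact hpath q p hqp.symm hq hbp fun i hi hi' => (hble i).trans (hdo i hi hi')
  have hbq : b q ≤ 6 := by rw [hbt q hq]; exact Nat.sub_le_sub_right hdq 1
  by_cases hall : ∀ i, has i
  swap
  · push Not at hall
    obtain ⟨j, hj⟩ := hall
    refine hpath j p (fun h => hj (h ▸ hp)) hj hbp fun i hi hi' => ?_
    by_cases hiq : i = q
    · rw [hiq]; exact hbq
    · exact (hble i).trans (hdo i hi hiq)
  have h1 : Ext4 G (B ∪ u '' (Finset.univ : Finset (Fin 5))) :=
    comb_cycle P b hP0 step p q hqp hbp hbq fun i hi hi' => by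
      rw [hbt i (hall i)]; exact Nat.sub_le_sub_right (hdo i hi hi') 1
  refine hfinal v (fun h => hI0X _ h hvX) ?_ ?_
  · intro z hz hvz
    exact hI0X z hz ((hXmem z).mpr (Or.inr ((hadj z).mp hvz)))
  · convert h1 using 1
    ext w
    simp only [Set.mem_compl_iff, Set.mem_insert_iff, not_or, Set.mem_union, Set.mem_image,
      Finset.coe_univ, Set.mem_univ, true_and]
    constructor
    · rintro ⟨h3, h4⟩
      by_cases h5 : w ∈ X
      · rcases (hXmem w).mp h5 with h6 | h6
        · exact absurd h6 h3
        · exact Or.inr h6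
      · exact Or.inl ⟨h5, h4⟩
    · rintro (h | ⟨i, rfl⟩)
      · exact ⟨fun h' => h.1 (h' ▸ hvX), h.2⟩
      · exact ⟨hvne i, fun h => hI0X _ h (huX i)⟩
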